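/- arXiv:1204.5496 — 3 statements merged into one kernel-verified Lean document; each statement's English description precedes it below -/
import Mathlib

section
/- Let M(φ) = ∑_{m=1}^∞ m A_m² sin(mφ). Then for every real k, the vortex configuration φ_1 = φ_2 = φ_3 = π/2 satisfies the three persistence conditions of the 4-site breather on a square lattice with diagonal coupling ratio k: M(φ_1) + M(φ_1+φ_2+φ_3) + k·M(φ_1+φ_2) = 0, M(φ_2) + M(φ_1+φ_2+φ_3) + k·[M(φ_1+φ_2) + M(φ_2+φ_3)] = 0, and M(φ_3) + M(φ_1+φ_2+φ_3) + k·M(φ_2+φ_3) = 0. -/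
/-- A sine series with integer frequencies is odd about `π`. No summability is needed. -/
theorem tsum_mul_sin_two_pi_sub (c : ℕ → ℝ) (φ : ℝ) :
    ∑' m : ℕ, c m * Real.sin (((m : ℝ) + 1) * (2 * Real.pi - φ)) =
      -∑' m : ℕ, c m * Real.sin (((m : ℝ) + 1) * φ) := by
  rw [← tsum_neg]
  refine tsum_congr fun m => ?_
  have h : ((m : ℝ) + 1) * (2 * Real.pi - φ) =
      ((m + 1 : ℕ) : ℝ) * (2 * Real.pi) - ((m : ℝ) + 1) * φ := by
    push_cast
    ring
  rw [h, Real.sin_nat_mul_two_pi_sub, mul_neg]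

/-- For every real `k`, the vortex configuration `φ₁ = φ₂ = φ₃ = π/2` satisfies the three
persistence conditions of the 4-site breather on a square lattice with diagonal coupling
ratio `k`, where `M φ = ∑_{m≥1} m (A m)^2 sin (m φ)`. -/
theorem stmt_8 (A : ℕ → ℝ) (hA : Summable fun m : ℕ => (m : ℝ) * (A m) ^ 2)
    (M : ℝ → ℝ)
    (hM : ∀ φ : ℝ, M φ = ∑' m : ℕ, ((m : ℝ) + 1) * (A (m + 1)) ^ 2 * Real.sin (((m : ℝ) + 1) * φ)) :
    ∀ k : ℝ, ∀ φ₁ φ₂ φ₃ : ℝ,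
      φ₁ = Real.pi / 2 → φ₂ = Real.pi / 2 → φ₃ = Real.pi / 2 →
      M φ₁ + M (φ₁ + φ₂ + φ₃) + k * M (φ₁ + φ₂) = 0 ∧
      M φ₂ + M (φ₁ + φ₂ + φ₃) + k * (M (φ₁ + φ₂) + M (φ₂ + φ₃)) = 0 ∧
      M φ₃ + M (φ₁ + φ₂ + φ₃) + k * M (φ₂ + φ₃) = 0 := by
  rintro k _ _ _ rfl rfl rfl
  have hodd (φ : ℝ) : M (2 * Real.pi - φ) = -M φ := by
    rw [hM, hM, tsum_mul_sin_two_pi_sub]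
  have hsum : Real.pi / 2 + Real.pi / 2 + Real.pi / 2 = 2 * Real.pi - Real.pi / 2 := by ring
  have hpi : M Real.pi = 0 := by
    have h := hodd Real.pi
    rw [show 2 * Real.pi - Real.pi = Real.pi by ring] at h
    linarith
  rw [hsum, hodd, add_halves, hpi]
  simp
end

section
/- For all real numbers f_1, f_2, g, k, the characteristic polynomial of the 3×3 real matrix Z = [[2f_1 + kg, kg − f_1, −kg], [−f_2, 2f_2 + 2kg, −f_2], [−kg, kg − f_1, 2f_1 + kg]] factors as (X − 2(f_1 + kg))·(X² − 2(f_1 + f_2 + kg)X + (f_1 + f_2 + kg)² − ((f_1 − kg)² + f_2²)); equivalently, since (f_1 − kg)² + f_2² ≥ 0, its eigenvalues are 2(f_1 + kg) and f_1 + f_2 + kg ± √(f_1² + f_2² − 2k f_1 g + k² g²). -/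
/-- For all real `f₁, f₂, g, k`, the characteristic polynomial of the 3×3 matrix
`Z = [[2f₁ + kg, kg − f₁, −kg], [−f₂, 2f₂ + 2kg, −f₂], [−kg, kg − f₁, 2f₁ + kg]]` factors as
`(X − 2(f₁ + kg))(X² − 2SX + S² − R)` with `S = f₁ + f₂ + kg` and `R = (f₁ − kg)² + f₂²`;
equivalently, since `R ≥ 0`, its eigenvalues are `2(f₁ + kg)` and
`S ± √(f₁² + f₂² − 2kf₁g + k²g²)`. -/
theorem stmt_13 (f₁ f₂ g k : ℝ) :
    Matrix.charpoly
        !![2 * f₁ + k * g, k * g - f₁, -(k * g);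
           -f₂, 2 * f₂ + 2 * k * g, -f₂;
           -(k * g), k * g - f₁, 2 * f₁ + k * g]
      = (Polynomial.X - Polynomial.C (2 * (f₁ + k * g))) *
          (Polynomial.X ^ 2
            - Polynomial.C (2 * (f₁ + f₂ + k * g)) * Polynomial.X
            + Polynomial.C ((f₁ + f₂ + k * g) ^ 2 - ((f₁ - k * g) ^ 2 + f₂ ^ 2))) ∧
    0 ≤ (f₁ - k * g) ^ 2 + f₂ ^ 2 ∧
    Matrix.charpoly
        !![2 * f₁ + k * g, k * g - f₁, -(k * g);
           -f₂, 2 * f₂ + 2 * k * g, -f₂;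
           -(k * g), k * g - f₁, 2 * f₁ + k * g]
      = (Polynomial.X - Polynomial.C (2 * (f₁ + k * g))) *
        (Polynomial.X - Polynomial.C (f₁ + f₂ + k * g +
          Real.sqrt (f₁ ^ 2 + f₂ ^ 2 - 2 * k * f₁ * g + k ^ 2 * g ^ 2))) *
        (Polynomial.X - Polynomial.C (f₁ + f₂ + k * g -
          Real.sqrt (f₁ ^ 2 + f₂ ^ 2 - 2 * k * f₁ * g + k ^ 2 * g ^ 2))) := by
  have hR : 0 ≤ (f₁ - k * g) ^ 2 + f₂ ^ 2 := by positivity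
  have hZ : Matrix.charpoly
        !![2 * f₁ + k * g, k * g - f₁, -(k * g);
           -f₂, 2 * f₂ + 2 * k * g, -f₂;
           -(k * g), k * g - f₁, 2 * f₁ + k * g]
      = (Polynomial.X - Polynomial.C (2 * (f₁ + k * g))) *
          (Polynomial.X ^ 2
            - Polynomial.C (2 * (f₁ + f₂ + k * g)) * Polynomial.X
            + Polynomial.C ((f₁ + f₂ + k * g) ^ 2 - ((f₁ - k * g) ^ 2 + f₂ ^ 2))) := by
    simp [Matrix.charpoly, Matrix.det_fin_three]
    simp only [map_ofNat]
    ring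
  refine ⟨hZ, hR, ?_⟩
  rw [hZ, mul_assoc]
  congr 1
  have hdisc : f₁ ^ 2 + f₂ ^ 2 - 2 * k * f₁ * g + k ^ 2 * g ^ 2
      = (f₁ - k * g) ^ 2 + f₂ ^ 2 := by ring
  rw [hdisc]
  set s := Real.sqrt ((f₁ - k * g) ^ 2 + f₂ ^ 2) with hs
  rw [← Real.sq_sqrt hR, ← hs]
  simp only [map_add, map_sub, map_mul, map_pow, map_ofNat]
  ring
end

section
/- For all real numbers f_1, f_2, g, h, k_2, k_3, the characteristic polynomial of the 3×3 real matrix Z = [[2f_1 + k_2 g + k_3 h, k_2 g − f_1, k_3 h − k_2 g], [k_3 h − f_2, 2f_2 + 2k_2 g, k_3 h − f_2], [k_3 h − k_2 g, k_2 g − f_1, 2f_1 + k_2 g + k_3 h]] factors as (X − 2(f_1 + k_2 g))·(X² − 2SX + S² − R), where S = f_1 + f_2 + k_2 g + k_3 h and R = (f_1 − k_2 g)² + (f_2 − k_3 h)²; equivalently, since R ≥ 0, its eigenvalues are 2(f_1 + k_2 g) and S ± √(f_1² + f_2² − 2k_2 f_1 g + k_2² g² − 2k_3 f_2 h + k_3²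 h²). -/
/-- For all real `f₁, f₂, g, h, k₂, k₃`, the characteristic polynomial of the 3×3 matrix
`Z = [[2f₁ + k₂g + k₃h, k₂g − f₁, k₃h − k₂g], [k₃h − f₂, 2f₂ + 2k₂g, k₃h − f₂],
[k₃h − k₂g, k₂g − f₁, 2f₁ + k₂g + k₃h]]` factors as `(X − 2(f₁ + k₂g))(X² − 2SX + S² − R)` with
`S = f₁ + f₂ + k₂g + k₃h` and `R = (f₁ − k₂g)² + (f₂ − k₃h)²`; equivalently, since `R ≥ 0`,
its eigenvalues are `2(f₁ + k₂g)` and `S ± √(f₁² + f₂² − 2k₂f₁g + k₂²g² − 2k₃f₂h + k₃²h²)`. -/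
theorem stmt_16 (f₁ f₂ g h k₂ k₃ : ℝ) :
    Matrix.charpoly
        !![2 * f₁ + k₂ * g + k₃ * h, k₂ * g - f₁, k₃ * h - k₂ * g;
           k₃ * h - f₂, 2 * f₂ + 2 * k₂ * g, k₃ * h - f₂;
           k₃ * h - k₂ * g, k₂ * g - f₁, 2 * f₁ + k₂ * g + k₃ * h]
      = (Polynomial.X - Polynomial.C (2 * (f₁ + k₂ * g))) *
          (Polynomial.X ^ 2
            - Polynomial.C (2 * (f₁ + f₂ + k₂ * g + k₃ * h)) * Polynomial.X
            + Polynomial.C ((f₁ + f₂ + k₂ * g + k₃ * h) ^ 2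
                - ((f₁ - k₂ * g) ^ 2 + (f₂ - k₃ * h) ^ 2))) ∧
    0 ≤ (f₁ - k₂ * g) ^ 2 + (f₂ - k₃ * h) ^ 2 ∧
    Matrix.charpoly
        !![2 * f₁ + k₂ * g + k₃ * h, k₂ * g - f₁, k₃ * h - k₂ * g;
           k₃ * h - f₂, 2 * f₂ + 2 * k₂ * g, k₃ * h - f₂;
           k₃ * h - k₂ * g, k₂ * g - f₁, 2 * f₁ + k₂ * g + k₃ * h]
      = (Polynomial.X - Polynomial.C (2 * (f₁ + k₂ * g))) *
        (Polynomial.X - Polynomial.C (f₁ + f₂ + k₂ * g + k₃ * h +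
          Real.sqrt (f₁ ^ 2 + f₂ ^ 2 - 2 * k₂ * f₁ * g + k₂ ^ 2 * g ^ 2
            - 2 * k₃ * f₂ * h + k₃ ^ 2 * h ^ 2))) *
        (Polynomial.X - Polynomial.C (f₁ + f₂ + k₂ * g + k₃ * h -
          Real.sqrt (f₁ ^ 2 + f₂ ^ 2 - 2 * k₂ * f₁ * g + k₂ ^ 2 * g ^ 2
            - 2 * k₃ * f₂ * h + k₃ ^ 2 * h ^ 2))) := by
  have hfactor : Matrix.charpoly
        !![2 * f₁ + k₂ * g + k₃ * h, k₂ * g - f₁, k₃ * h - k₂ * g;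
           k₃ * h - f₂, 2 * f₂ + 2 * k₂ * g, k₃ * h - f₂;
           k₃ * h - k₂ * g, k₂ * g - f₁, 2 * f₁ + k₂ * g + k₃ * h]
      = (Polynomial.X - Polynomial.C (2 * (f₁ + k₂ * g))) *
          (Polynomial.X ^ 2
            - Polynomial.C (2 * (f₁ + f₂ + k₂ * g + k₃ * h)) * Polynomial.X
            + Polynomial.C ((f₁ + f₂ + k₂ * g + k₃ * h) ^ 2
                - ((f₁ - k₂ * g) ^ 2 + (f₂ - k₃ * h) ^ 2))) := by
    simp [Matrix.charpoly, Matrix.det_fin_three]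
    rw [show (Polynomial.C (2 : ℝ)) = 2 from map_ofNat Polynomial.C 2]
    ring
  have hR : 0 ≤ (f₁ - k₂ * g) ^ 2 + (f₂ - k₃ * h) ^ 2 := by positivity
  refine ⟨hfactor, hR, ?_⟩
  rw [hfactor, show f₁ ^ 2 + f₂ ^ 2 - 2 * k₂ * f₁ * g + k₂ ^ 2 * g ^ 2
    - 2 * k₃ * f₂ * h + k₃ ^ 2 * h ^ 2 = (f₁ - k₂ * g) ^ 2 + (f₂ - k₃ * h) ^ 2 by ring, mul_assoc]
  congr 1
  nth_rw 1 [← Real.sq_sqrt hR]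
  generalize √((f₁ - k₂ * g) ^ 2 + (f₂ - k₃ * h) ^ 2) = r
  simp only [map_add, map_sub, map_mul, map_pow, map_ofNat]
  ring
end
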